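/- For all integers r ≥ 3 and t ≥ r+3 there exist real constants c, C > 0 and an integer N such that for every integer n ≥ N: (a) every K_r-saturated graph G on n vertices with minimum degree at least t, in which for every pair of distinct twin vertices there is a vertex of degree exactly t adjacent to both of them, satisfies e(G) ≥ t·n + c·n^{1/(t-r+2)}; and (b) there exists a K_r-saturated graph G on n vertices with minimum degree at least t, in which every pair of distinct twin vertices has a common neighbour of degree exactly t, satisfying e(G) ≤ t·n + C·n^{4/(t-r+2)}. -/

import Mathlib

open SimpleGraph

/-- `G` is `K_r`-saturated: `G` contains no `r`-clique, but adding any missing edge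
creates an `r`-clique. -/
def Ksat (r : ℕ) {V : Type*} (G : SimpleGraph V) : Prop :=
  G.CliqueFree r ∧ ∀ u v : V, u ≠ v → ¬ G.Adj u v →
    ¬ (G ⊔ fromEdgeSet {s(u, v)}).CliqueFree r

/-- `G` is twin-free: distinct vertices have distinct neighbourhoods. -/
def TwinFree {V : Type*} (G : SimpleGraph V) : Prop :=
  ∀ u v : V, G.neighborSet u = G.neighborSet v → u = v

/-- Minimum degree of `G` is at least `t`. -/
def MinDegGe {V : Type*} (G : SimpleGraph V) (t : ℕ) : Prop :=
  ∀ v : V, t ≤ (G.neighborSet v).ncard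

/-- Every pair of distinct twins has a common neighbour of degree exactly `t`. -/
def TwinCond {V : Type*} (G : SimpleGraph V) (t : ℕ) : Prop :=
  ∀ u v : V, u ≠ v → G.neighborSet u = G.neighborSet v →
    ∃ w : V, (G.neighborSet w).ncard = t ∧ G.Adj w u ∧ G.Adj w v

/-- An `(r,t)`-system. -/
def IsRTSystem (r t : ℕ) {V : Type*} [DecidableEq V] (H : SimpleGraph V)
    (F : Finset (Finset V)) : Prop :=
  H.CliqueFree r ∧
  (∀ S ∈ F, S.card = t ∧
    (H.induce (S : Set V)).CliqueFree (r - 1) ∧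
    ∀ v : V, v ∉ S → ¬ (H.induce ((insert v S : Finset V) : Set V)).CliqueFree (r - 1)) ∧
  (∀ S ∈ F, ∀ T ∈ F, S ≠ T → ¬ (H.induce ((S ∩ T : Finset V) : Set V)).CliqueFree (r - 2))

/-- A maximal `(r,t)`-system. -/
def IsMaxRTSystem (r t : ℕ) {V : Type*} [DecidableEq V] (H : SimpleGraph V)
    (F : Finset (Finset V)) : Prop :=
  IsRTSystem r t H F ∧
  ∀ u v : V, u ≠ v → ¬ H.Adj u v →
    ¬ (H ⊔ fromEdgeSet {s(u, v)}).CliqueFree r ∨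
    ∃ S ∈ F, ¬ (((H ⊔ fromEdgeSet {s(u, v)}).induce (S : Set V)).CliqueFree (r - 1))

/-- A `(3,t)`-system. -/
def Is3TSystem (t : ℕ) {V : Type*} [DecidableEq V] (H : SimpleGraph V)
    (F : Finset (Finset V)) : Prop :=
  H.CliqueFree 3 ∧
  (∀ S ∈ F, S.card = t ∧
    (∀ u ∈ S, ∀ v ∈ S, ¬ H.Adj u v) ∧
    (∀ v : V, v ∉ S → ∃ u ∈ S, H.Adj v u)) ∧
  (∀ S ∈ F, ∀ T ∈ F, S ≠ T → (S ∩ T).Nonempty)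

/-- A maximal `(3,t)`-system. -/
def IsMax3TSystem (t : ℕ) {V : Type*} [DecidableEq V] (H : SimpleGraph V)
    (F : Finset (Finset V)) : Prop :=
  Is3TSystem t H F ∧
  ∀ u v : V, u ≠ v → ¬ H.Adj u v →
    ¬ (H ⊔ fromEdgeSet {s(u, v)}).CliqueFree 3 ∨ ∃ S ∈ F, u ∈ S ∧ v ∈ S

noncomputable def s3 (t m : ℕ) : ℕ :=
  sSup {a : ℕ | ∃ (H : SimpleGraph (Fin m)) (F : Finset (Finset (Fin m))),
    Is3TSystem t H F ∧ F.card = a}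

noncomputable def ePrime (r t s : ℕ) : ℕ :=
  sInf {e : ℕ | ∃ (m : ℕ) (H : SimpleGraph (Fin m)) (F : Finset (Finset (Fin m))),
    IsMaxRTSystem r t H F ∧ F.card = s ∧ H.edgeSet.ncard = e}

noncomputable def e3min (t s : ℕ) : ℕ :=
  sInf {e : ℕ | ∃ (m : ℕ) (H : SimpleGraph (Fin m)) (F : Finset (Finset (Fin m))),
    Is3TSystem t H F ∧ F.card = s ∧ H.edgeSet.ncard = e}

/-- Sets `A i` disjoint from the bounded sets `B i` can all be missed by boundedly many `B j`. -/
theorem exists_subset_card_le_forall_disjoint {ι α : Type*} [DecidableEq ι] [DecidableEq α]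
    (b : ℕ) : ∀ (a : ℕ) (I : Finset ι) (A B : ι → Finset α),
      (∀ i ∈ I, (A i).card ≤ a) → (∀ i ∈ I, (B i).card ≤ b) →
      (∀ i ∈ I, Disjoint (A i) (B i)) →
      ∃ J ⊆ I, J.card ≤ (b + 1) ^ a ∧ ∀ i ∈ I, ∃ j ∈ J, Disjoint (A i) (B j) := by
  intro a
  induction a with
  | zero =>
    intro I A B hA hB _
    obtain rfl | ⟨i₀, hi₀⟩ := I.eq_empty_or_nonempty
    · exact ⟨∅, by simp⟩
    · refine ⟨{i₀}, by simpa using hi₀, by simp, fun i hi => ⟨i₀, by simp, ?_⟩⟩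
      have := hA i hi
      simp_all
  | succ a ih =>
    intro I A B hA hB hAB
    obtain rfl | ⟨i₀, hi₀⟩ := I.eq_empty_or_nonempty
    · exact ⟨∅, by simp⟩
    have key : ∀ x, ∃ J ⊆ I.filter (fun i => x ∈ A i), J.card ≤ (b + 1) ^ a ∧
        ∀ i ∈ I.filter (fun i => x ∈ A i), ∃ j ∈ J, Disjoint ((A i).erase x) (B j) := by
      intro x
      refine ih _ (fun i => (A i).erase x) B ?_ ?_ ?_
      · intro i hi
        rw [Finset.mem_filter] at hi
        have := hA i hi.1
        rw [Finset.card_erase_of_mem hi.2]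
        omega
      · exact fun i hi => hB i (Finset.mem_filter.1 hi).1
      · exact fun i hi => (hAB i (Finset.mem_filter.1 hi).1).mono_left (Finset.erase_subset _ _)
    choose J hJI hJc hJ using key
    refine ⟨insert i₀ ((B i₀).biUnion J), ?_, ?_, ?_⟩
    · intro j hj
      rw [Finset.mem_insert, Finset.mem_biUnion] at hj
      obtain rfl | ⟨x, -, hx⟩ := hj
      · exact hi₀
      · exact (Finset.mem_filter.1 (hJI x hx)).1
    · have h1 : ((B i₀).biUnion J).card ≤ (B i₀).card * (b + 1) ^ a :=
        Finset.card_biUnion_le_card_mul _ _ _ fun x _ => hJc x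
      have h2 : (B i₀).card * (b + 1) ^ a ≤ b * (b + 1) ^ a :=
        Nat.mul_le_mul_right _ (hB i₀ hi₀)
      have h3 : 1 ≤ (b + 1) ^ a := Nat.one_le_pow _ _ (by omega)
      calc _ ≤ ((B i₀).biUnion J).card + 1 := Finset.card_insert_le _ _
        _ ≤ b * (b + 1) ^ a + (b + 1) ^ a := by omega
        _ = (b + 1) ^ (a + 1) := by ring
    · intro i hi
      by_cases hd : Disjoint (A i) (B i₀)
      · exact ⟨i₀, by simp, hd⟩
      · obtain ⟨x, hxA, hxB⟩ := Finset.not_disjoint_iff.1 hd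
        obtain ⟨j, hj, hdj⟩ := hJ x i (Finset.mem_filter.2 ⟨hi, hxA⟩)
        refine ⟨j, Finset.mem_insert_of_mem (Finset.mem_biUnion.2 ⟨x, hxB, hj⟩), ?_⟩
        have hj' := Finset.mem_filter.1 (hJI x hj)
        have hxj : x ∉ B j := Finset.disjoint_left.1 (hAB j hj'.1) hj'.2
        rw [Finset.disjoint_left] at hdj ⊢
        intro y hy hyB
        refine hdj (Finset.mem_erase.2 ⟨?_, hy⟩) hyB
        rintro rfl
        exact hxj hyB

theorem Ksat.exists_common_clique {r : ℕ} {V : Type*} {G : SimpleGraph V}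
    (hG : Ksat r G) {u v : V} (huv : u ≠ v) (hadj : ¬ G.Adj u v) :
    ∃ s : Finset V, G.IsNClique (r - 2) s ∧ ∀ x ∈ s, G.Adj u x ∧ G.Adj v x := by
  classical
  have h := hG.2 u v huv hadj
  simp only [CliqueFree, not_forall, not_not] at h
  obtain ⟨s, hs⟩ := h
  have hmem : ∀ w z, s(w, z) = s(u, v) → w ∈ s := by
    intro w z hwz
    by_contra hw
    refine hG.1 s ⟨?_, hs.2⟩
    intro a ha b hb hab
    have h1 := hs.1 ha hb hab
    rw [sup_adj, fromEdgeSet_adj] at h1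
    refine h1.resolve_right fun h2 => ?_
    have h3 : s(a, b) = s(w, z) := by rw [hwz]; exact h2.1
    rw [Sym2.eq_iff] at h3
    rcases h3 with ⟨rfl, -⟩ | ⟨-, rfl⟩
    · exact hw ha
    · exact hw hb
  have hu := hmem u v rfl
  have hv := hmem v u Sym2.eq_swap
  have hadj' : ∀ a ∈ s, ∀ b ∈ s, a ≠ b → b ≠ u → b ≠ v → G.Adj a b := by
    intro a ha b hb hab hbu hbv
    have h1 := hs.1 ha hb hab
    rw [sup_adj, fromEdgeSet_adj] at h1
    refine h1.resolve_right fun h2 => ?_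
    have h3 : s(a, b) = s(u, v) := h2.1
    rw [Sym2.eq_iff] at h3
    rcases h3 with ⟨-, h⟩ | ⟨-, h⟩
    · exact hbv h
    · exact hbu h
  refine ⟨(s.erase u).erase v, ⟨?_, ?_⟩, ?_⟩
  · intro a ha b hb hab
    simp only [Finset.coe_erase, Set.mem_sdiff, Finset.mem_coe, Set.mem_singleton_iff] at ha hb
    exact hadj' a ha.1.1 b hb.1.1 hab hb.1.2 hb.2
  · rw [Finset.card_erase_of_mem (Finset.mem_erase.2 ⟨huv.symm, hv⟩), Finset.card_erase_of_mem hu,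
      hs.2]
    omega
  · intro x hx
    simp only [Finset.mem_erase] at hx
    exact ⟨hadj' u hu x hx.2.2 (Ne.symm hx.2.1) hx.2.1 hx.1,
      hadj' v hv x hx.2.2 (Ne.symm hx.1) hx.2.1 hx.1⟩

section LowerBound

open scoped Classical

variable {V : Type*} [Fintype V]

/-- In a saturated graph, boundedly many vertices meet the neighbourhood of each first vertex of
an edge in `I` outside its prescribed part `A`. -/
theorem Ksat.exists_card_le_forall_adj_notMem {r : ℕ} {G : SimpleGraph V} (hr : 2 ≤ r)
    (hG : Ksat r G) (a D : ℕ) (I : Finset (V × V)) (A : V → Finset V)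
    (hI : ∀ p ∈ I, G.Adj p.1 p.2 ∧ (A p.1).card ≤ a ∧ G.degree p.2 ≤ D)
    (hA : ∀ v, ∀ x ∈ A v, G.Adj v x) :
    ∃ Q : Finset V, Q.card ≤ (2 ^ D + 1) ^ (2 ^ a) * (D + 1) ∧
      ∀ p ∈ I, p.1 ∈ Q ∨ ∃ x ∈ Q, G.Adj p.1 x ∧ x ∉ A p.1 := by
  let cl : Finset V → Finset (Finset V) := fun S =>
    S.powerset.filter fun s => G.IsNClique (r - 2) s
  have hcA : ∀ p ∈ I, (cl (A p.1)).card ≤ 2 ^ a := by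
    intro p hp
    refine (Finset.card_filter_le _ _).trans ?_
    rw [Finset.card_powerset]
    exact Nat.pow_le_pow_right (by omega) (hI p hp).2.1
  have hcB : ∀ p ∈ I, (cl (G.neighborFinset p.2)).card ≤ 2 ^ D := by
    intro p hp
    refine (Finset.card_filter_le _ _).trans ?_
    rw [Finset.card_powerset, card_neighborFinset_eq_degree]
    exact Nat.pow_le_pow_right (by omega) (hI p hp).2.2
  have hAB : ∀ p ∈ I, Disjoint (cl (A p.1)) (cl (G.neighborFinset p.2)) := by
    intro p hp
    rw [Finset.disjoint_left]
    intro s hs hs'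
    simp only [cl, Finset.mem_filter, Finset.mem_powerset] at hs hs'
    have h1 : G.IsNClique (r - 2 + 1) (insert p.2 s) :=
      hs.2.insert fun x hx => by simpa using hs'.1 hx
    have h2 : G.IsNClique (r - 2 + 1 + 1) (insert p.1 (insert p.2 s)) := by
      refine h1.insert fun x hx => ?_
      obtain rfl | hx := Finset.mem_insert.1 hx
      · exact (hI p hp).1
      · exact hA _ _ (hs.1 hx)
    rw [show r - 2 + 1 + 1 = r by omega] at h2
    exact hG.1 _ h2
  obtain ⟨J, hJI, hJc, hJ⟩ := exists_subset_card_le_forall_disjoint (2 ^ D) (2 ^ a) I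
    (fun p => cl (A p.1)) (fun p => cl (G.neighborFinset p.2)) hcA hcB hAB
  refine ⟨J.biUnion fun p => insert p.2 (G.neighborFinset p.2), ?_, ?_⟩
  · refine (Finset.card_biUnion_le_card_mul _ _ (D + 1) fun p hp => ?_).trans
      (Nat.mul_le_mul_right _ hJc)
    refine (Finset.card_insert_le _ _).trans ?_
    rw [card_neighborFinset_eq_degree]
    have := (hI p (hJI hp)).2.2
    omega
  · intro p hp
    obtain ⟨j, hj, hd⟩ := hJ p hp
    by_cases hpj : p.1 = j.2 ∨ G.Adj p.1 j.2
    · left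
      rw [Finset.mem_biUnion]
      refine ⟨j, hj, ?_⟩
      rw [Finset.mem_insert, mem_neighborFinset]
      exact hpj.imp_right fun h => h.symm
    · rw [not_or] at hpj
      right
      obtain ⟨s, hs, hsx⟩ := hG.exists_common_clique hpj.1 hpj.2
      by_contra! hno
      have hmem : ∀ x ∈ s, x ∈ A p.1 := fun x hx => by
        refine hno x ?_ (hsx x hx).1
        rw [Finset.mem_biUnion]
        exact ⟨j, hj, by simp [(hsx x hx).2]⟩
      refine Finset.disjoint_left.1 hd (?_ : s ∈ _) ?_
      · simpa [cl, hs] using Finset.subset_iff.2 hmem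
      · simp only [cl, Finset.mem_filter, Finset.mem_powerset, hs, and_true]
        intro x hx
        simpa using (hsx x hx).2

/-- The vertices reached from `R` in `i` rounds, a vertex being reached once it has `t`
neighbours that were reached earlier. -/
noncomputable def reachStage (G : SimpleGraph V) (t : ℕ) (R : Finset V) : ℕ → Finset V
  | 0 => R
  | i + 1 => reachStage G t R i ∪
      Finset.univ.filter fun v => t ≤ (G.neighborFinset v ∩ reachStage G t R i).card

/-- The vertices eventually reached from `R`. -/
noncomputable def reachClosure (G : SimpleGraph V) (t : ℕ) (R : Finset V) : Finset V :=
  Finset.univ.filter fun v => ∃ i, v ∈ reachStage G t R i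

theorem mem_reachClosure {G : SimpleGraph V} {t : ℕ} {R : Finset V} {v : V} :
    v ∈ reachClosure G t R ↔ ∃ i, v ∈ reachStage G t R i := by
  simp [reachClosure]

theorem mem_reachStage_succ {G : SimpleGraph V} {t : ℕ} {R : Finset V} {i : ℕ} {v : V} :
    v ∈ reachStage G t R (i + 1) ↔ v ∈ reachStage G t R i ∨
      t ≤ (G.neighborFinset v ∩ reachStage G t R i).card := by
  simp [reachStage]

theorem reachStage_mono (G : SimpleGraph V) (t : ℕ) (R : Finset V) :
    Monotone (reachStage G t R) :=
  monotone_nat_of_le_succ fun _ _ hv => mem_reachStage_succ.2 (Or.inl hv)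

theorem subset_reachClosure (G : SimpleGraph V) (t : ℕ) (R : Finset V) :
    R ⊆ reachClosure G t R := fun _ hv => mem_reachClosure.2 ⟨0, hv⟩

theorem reachClosure_mono (G : SimpleGraph V) (t : ℕ) {R R' : Finset V} (h : R ⊆ R') :
    reachClosure G t R ⊆ reachClosure G t R' := by
  have key : ∀ i, reachStage G t R i ⊆ reachStage G t R' i := by
    intro i
    induction i with
    | zero => exact h
    | succ i ih =>
      intro v hv
      rw [mem_reachStage_succ] at hv ⊢
      exact hv.imp (fun h => ih h) fun h => h.trans
        (Finset.card_le_card (Finset.inter_subset_inter_left ih))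
  intro v hv
  rw [mem_reachClosure] at hv ⊢
  exact hv.imp fun i hi => key i hi

theorem exists_reachClosure_eq (G : SimpleGraph V) (t : ℕ) (R : Finset V) :
    ∃ M, reachClosure G t R = reachStage G t R M := by
  have h : ∀ v : V, ∃ i, v ∈ reachClosure G t R → v ∈ reachStage G t R i := by
    intro v
    by_cases hv : v ∈ reachClosure G t R
    · exact (mem_reachClosure.1 hv).imp fun i hi _ => hi
    · exact ⟨0, fun h => absurd h hv⟩
  choose g hg using h
  refine ⟨Finset.univ.sup g, Finset.Subset.antisymm ?_ ?_⟩
  · exact fun v hv => reachStage_mono G t R (Finset.le_sup (Finset.mem_univ v)) (hg v hv)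
  · exact fun v hv => mem_reachClosure.2 ⟨_, hv⟩

theorem mem_reachClosure_of_le {G : SimpleGraph V} {t : ℕ} {R : Finset V} {v : V}
    (h : t ≤ (G.neighborFinset v ∩ reachClosure G t R).card) : v ∈ reachClosure G t R := by
  obtain ⟨M, hM⟩ := exists_reachClosure_eq G t R
  rw [hM] at h
  exact mem_reachClosure.2 ⟨M + 1, mem_reachStage_succ.2 (Or.inr h)⟩

/-- In a saturated graph of minimum degree at least `t`, a bounded set reaches all vertices of
bounded degree. -/
theorem Ksat.exists_reachClosure {r t : ℕ} {G : SimpleGraph V} (hr : 2 ≤ r)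
    (hG : Ksat r G) (hdeg : ∀ v, t ≤ G.degree v) (D : ℕ) :
    ∃ R : Finset V, R.card ≤ t * ((2 ^ D + 1) ^ (2 ^ t) * (D + 1)) ∧
      ∀ v ∉ reachClosure G t R, D < G.degree v := by
  have key : ∀ j : ℕ, ∃ R : Finset V, R.card ≤ j * ((2 ^ D + 1) ^ (2 ^ t) * (D + 1)) ∧
      ∀ y ∉ reachClosure G t R, ∀ v ∉ reachClosure G t R, G.Adj y v → G.degree v ≤ D →
        j ≤ (G.neighborFinset y ∩ reachClosure G t R).card := by
    intro j
    induction j with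
    | zero => exact ⟨∅, by simp⟩
    | succ j ih =>
      obtain ⟨R, hRc, hR⟩ := ih
      let I : Finset (V × V) := Finset.univ.filter fun p => p.1 ∉ reachClosure G t R ∧
        p.2 ∉ reachClosure G t R ∧ G.Adj p.1 p.2 ∧ G.degree p.2 ≤ D
      have hI : ∀ p ∈ I, G.Adj p.1 p.2 ∧
          (G.neighborFinset p.1 ∩ reachClosure G t R).card ≤ t ∧ G.degree p.2 ≤ D := by
        intro p hp
        simp only [I, Finset.mem_filter, Finset.mem_univ, true_and] at hp
        refine ⟨hp.2.2.1, ?_, hp.2.2.2⟩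
        by_contra h
        exact hp.1 (mem_reachClosure_of_le (by omega))
      obtain ⟨Q, hQc, hQ⟩ := hG.exists_card_le_forall_adj_notMem hr t D I
        (fun v => G.neighborFinset v ∩ reachClosure G t R) hI
        fun v x hx => by simpa using (Finset.mem_inter.1 hx).1
      refine ⟨R ∪ Q, ?_, ?_⟩
      · refine (Finset.card_union_le _ _).trans ?_
        rw [Nat.succ_mul]
        omega
      · intro y hy v hv hyv hvD
        have hsub := reachClosure_mono G t (Finset.subset_union_left : R ⊆ R ∪ Q)
        have hQsub : Q ⊆ reachClosure G t (R ∪ Q) :=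
          Finset.subset_union_right.trans (subset_reachClosure G t _)
        have hy' : y ∉ reachClosure G t R := fun h => hy (hsub h)
        have hv' : v ∉ reachClosure G t R := fun h => hv (hsub h)
        have h1 := hR y hy' v hv' hyv hvD
        rcases hQ (y, v) (by simp [I, hy', hv', hyv, hvD]) with h | ⟨x, hxQ, hxy, hx⟩
        · exact absurd (hQsub h) hy
        · refine Nat.succ_le_of_lt (h1.trans_lt (Finset.card_lt_card ?_))
          rw [Finset.ssubset_iff_of_subset (Finset.inter_subset_inter_left hsub)]
          exact ⟨x, by simpa using ⟨hxy, hQsub hxQ⟩, hx⟩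
  obtain ⟨R, hRc, hR⟩ := key t
  refine ⟨R, hRc, fun v hv => ?_⟩
  by_contra! hvD
  have h1 : ¬ t ≤ (G.neighborFinset v ∩ reachClosure G t R).card :=
    fun h => hv (mem_reachClosure_of_le h)
  have h2 : ¬ G.neighborFinset v ⊆ reachClosure G t R := by
    intro h
    rw [Finset.inter_eq_left.2 h, card_neighborFinset_eq_degree] at h1
    exact h1 (hdeg v)
  obtain ⟨y, hyv, hy⟩ := Finset.not_subset.1 h2
  rw [mem_neighborFinset] at hyv
  exact hy (mem_reachClosure_of_le (hR y hy v hv hyv.symm hvD))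

theorem exists_rank (G : SimpleGraph V) (t : ℕ) (R : Finset V) :
    ∃ f : V → ℕ, (∀ v, f v = 0 ↔ v ∈ R) ∧
      (∀ v ∈ reachClosure G t R, f v ≠ 0 →
        t ≤ ((G.neighborFinset v).filter fun u => f u < f v).card) ∧
      ∀ v ∉ reachClosure G t R, ∀ u, f u ≤ f v := by
  obtain ⟨M, hM⟩ := exists_reachClosure_eq G t R
  let f : V → ℕ := fun v => if h : ∃ i, v ∈ reachStage G t R i then Nat.find h else M + 1
  have hfin : ∀ v i, v ∈ reachStage G t R i → f v ≤ i := by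
    intro v i hi
    have h : ∃ i, v ∈ reachStage G t R i := ⟨i, hi⟩
    simp only [f, dif_pos h]
    exact Nat.find_min' h hi
  have hmem : ∀ v ∈ reachClosure G t R, v ∈ reachStage G t R (f v) := by
    intro v hv
    have h := mem_reachClosure.1 hv
    simp only [f, dif_pos h]
    exact Nat.find_spec h
  have hout : ∀ v ∉ reachClosure G t R, f v = M + 1 := by
    intro v hv
    rw [mem_reachClosure] at hv
    simp only [f, dif_neg hv]
  refine ⟨f, fun v => ⟨fun h => ?_, fun h => ?_⟩, fun v hv h0 => ?_, fun v hv u => ?_⟩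
  · by_cases hv : v ∈ reachClosure G t R
    · have := hmem v hv
      rwa [h] at this
    · have := hout v hv
      omega
  · exact Nat.le_zero.1 (hfin v 0 h)
  · obtain ⟨i, hi⟩ := Nat.exists_eq_succ_of_ne_zero h0
    have h1 := hmem v hv
    rw [hi, Nat.succ_eq_add_one, mem_reachStage_succ] at h1
    have h2 : v ∉ reachStage G t R i := fun h => by
      have := hfin v i h
      omega
    refine (h1.resolve_left h2).trans (Finset.card_le_card fun u hu => ?_)
    rw [Finset.mem_inter] at hu
    have := hfin u i hu.2
    exact Finset.mem_filter.2 ⟨hu.1, by omega⟩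
  · rw [hout v hv]
    by_cases hu : u ∈ reachClosure G t R
    · have h := hu
      rw [hM] at h
      have := hfin u M h
      omega
    · exact (hout u hu).le

/-- Twice the number of edges from `v` to lower ranks, plus the number of edges from `v` within
its rank; vertices of rank `0` get nothing. -/
noncomputable def rankWeight (G : SimpleGraph V) (f : V → ℕ) (v : V) : ℕ :=
  if f v = 0 then 0 else 2 * ((G.neighborFinset v).filter fun u => f u < f v).card +
    ((G.neighborFinset v).filter fun u => f u = f v).card

theorem sum_rankWeight_le (G : SimpleGraph V) (f : V → ℕ) :
    ∑ v, rankWeight G f v ≤ 2 * G.edgeFinset.card := by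
  let c : V → V → ℕ := fun v u => if G.Adj v u then
    (if f v = 0 then 0 else 2 * (if f u < f v then 1 else 0) + if f u = f v then 1 else 0) else 0
  have h1 : ∀ v, rankWeight G f v = ∑ u, c v u := by
    intro v
    rw [rankWeight]
    have : ∀ (p : V → Prop) [DecidablePred p], ((G.neighborFinset v).filter p).card =
        ∑ u, if G.Adj v u then (if p u then 1 else 0) else 0 := by
      intro p _
      rw [← Finset.sum_filter, ← Finset.sum_filter, Finset.card_eq_sum_ones]
      refine Finset.sum_congr ?_ fun _ _ => rfl
      ext u
      simp
    split_ifs with h0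
    · simp [c, h0]
    · rw [this, this, Finset.mul_sum, ← Finset.sum_add_distrib]
      refine Finset.sum_congr rfl fun u _ => ?_
      simp only [c, h0, if_false]
      split_ifs <;> simp
  have h2 : ∀ v u, c v u + c u v ≤ 2 * if G.Adj v u then 1 else 0 := by
    intro v u
    simp only [c, G.adj_comm u v]
    split_ifs <;> omega
  have h3 : ∑ v, ∑ u, c v u + ∑ v, ∑ u, c u v ≤ ∑ v, ∑ u, 2 * if G.Adj v u then 1 else 0 := by
    rw [← Finset.sum_add_distrib]
    refine Finset.sum_le_sum fun v _ => ?_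
    rw [← Finset.sum_add_distrib]
    exact Finset.sum_le_sum fun u _ => h2 v u
  rw [Finset.sum_comm (f := fun v u => c u v)] at h3
  have h4 : ∑ v, ∑ u, 2 * (if G.Adj v u then 1 else 0) = 2 * ∑ v, G.degree v := by
    rw [Finset.mul_sum]
    refine Finset.sum_congr rfl fun v _ => ?_
    rw [← Finset.mul_sum, ← card_neighborFinset_eq_degree, neighborFinset_eq_filter,
      Finset.card_filter]
  rw [h4, sum_degrees_eq_twice_card_edges] at h3
  simp_rw [h1]
  omega

/-- A rank function with few vertices of rank `0` for which every other vertex has weight at least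
`2 * t`, with equality only if it has exactly `t` edges to lower ranks and none within its rank. -/
theorem Ksat.exists_rank {r t : ℕ} {G : SimpleGraph V} (hr : 2 ≤ r)
    (hG : Ksat r G) (hdeg : ∀ v, t ≤ G.degree v) (D : ℕ) (hD : 2 * t ≤ D) :
    ∃ f : V → ℕ, (Finset.univ.filter fun v => f v = 0).card ≤
        t * ((2 ^ D + 1) ^ (2 ^ t) * (D + 1)) ∧
      ∀ v, f v ≠ 0 → 2 * t + 1 ≤ rankWeight G f v ∨ (rankWeight G f v = 2 * t ∧
        ((G.neighborFinset v).filter fun u => f u < f v).card = t ∧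
        ∀ u, G.Adj v u → f u ≠ f v) := by
  obtain ⟨R, hRc, hR⟩ := hG.exists_reachClosure hr hdeg D
  obtain ⟨f, hf0, hf1, hf2⟩ := _root_.exists_rank G t R
  refine ⟨f, ?_, fun v hv => ?_⟩
  · rwa [show (Finset.univ.filter fun v => f v = 0) = R by ext v; simp [hf0]]
  · have hw : rankWeight G f v = 2 * ((G.neighborFinset v).filter fun u => f u < f v).card +
        ((G.neighborFinset v).filter fun u => f u = f v).card := if_neg hv
    by_cases hvc : v ∈ reachClosure G t R
    · have h1 := hf1 v hvc hv
      by_cases h2 : 2 * t + 1 ≤ rankWeight G f v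
      · exact Or.inl h2
      · refine Or.inr ⟨by omega, by omega, fun u hu hfu => ?_⟩
        have h3 : 0 < ((G.neighborFinset v).filter fun u => f u = f v).card :=
          Finset.card_pos.2 ⟨u, by simpa using ⟨hu, hfu⟩⟩
        omega
    · left
      have h1 := hR v hvc
      rw [← card_neighborFinset_eq_degree,
        ← Finset.card_filter_add_card_filter_not (s := G.neighborFinset v) (fun u => f u < f v)] at h1
      have h2 : ((G.neighborFinset v).filter fun u => ¬ f u < f v) =
          (G.neighborFinset v).filter fun u => f u = f v :=
        Finset.filter_congr fun u _ => by
          have := hf2 v hvc u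
          omega
      rw [h2] at h1
      omega

theorem rankWeight_eq_sum (G : SimpleGraph V) {f : V → ℕ} {v : V} (hv : f v ≠ 0) :
    rankWeight G f v = ∑ u ∈ G.neighborFinset v,
      if f u < f v then 2 else if f u = f v then 1 else 0 := by
  rw [rankWeight, if_neg hv, Finset.card_filter, Finset.card_filter, Finset.mul_sum,
    ← Finset.sum_add_distrib]
  refine Finset.sum_congr rfl fun u _ => ?_
  split_ifs <;> omega

theorem rankWeight_le_of_le (G : SimpleGraph V) {f g : V → ℕ} {v : V} (hv : f v ≠ 0)
    (hgv : g v = f v) (hgf : ∀ u, g u ≤ f u) : rankWeight G f v ≤ rankWeight G g v := by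
  rw [rankWeight_eq_sum G hv, rankWeight_eq_sum G (hgv.trans_ne hv)]
  refine Finset.sum_le_sum fun u _ => ?_
  have := hgf u
  split_ifs <;> omega

theorem rankWeight_lt_of_le (G : SimpleGraph V) {f g : V → ℕ} {v x : V} (hv : f v ≠ 0)
    (hgv : g v = f v) (hgf : ∀ u, g u ≤ f u) (hx : G.Adj v x) (hfx : f v ≤ f x)
    (hgx : g x < f v) : rankWeight G f v < rankWeight G g v := by
  rw [rankWeight_eq_sum G hv, rankWeight_eq_sum G (hgv.trans_ne hv)]
  refine Finset.sum_lt_sum (fun u _ => ?_) ⟨x, by simpa using hx, ?_⟩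
  · have := hgf u
    split_ifs <;> omega
  · split_ifs <;> omega

/-- The vertices of a saturated graph that are not leaves are bounded in terms of the surplus of
edges, where the leaves are vertices of degree `t` forming an independent set. -/
theorem Ksat.exists_leaves {r t : ℕ} (hr : 2 ≤ r) : ∃ C C' : ℕ, ∀ (V : Type*) [Fintype V]
    (G : SimpleGraph V), Ksat r G → (∀ v, t ≤ G.degree v) →
    ∃ T : Finset V, (∀ v ∈ T, G.degree v = t ∧ ∀ u, G.Adj v u → u ∉ T) ∧
      Tᶜ.card + C * (2 * t * Fintype.card V) ≤ C * (2 * G.edgeFinset.card) + C' := by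
  obtain ⟨κ, hκ⟩ : ∃ κ, κ = (2 ^ (2 * t + 1) + 1) ^ (2 ^ t) * ((2 * t + 1) + 1) := ⟨_, rfl⟩
  refine ⟨2 * t + 3, (2 * t + 3) * (2 * t * (t * κ + κ) + κ) + t * κ, fun V _ G hG hdeg => ?_⟩
  obtain ⟨f, hf0, hf⟩ := hG.exists_rank hr hdeg (2 * t + 1) (by omega)
  rw [← hκ] at hf0
  have hw : ∀ v, f v ≠ 0 → 2 * t ≤ rankWeight G f v := fun v hv => by
    rcases hf v hv with h | h <;> omega
  let S := Finset.univ.filter fun v => f v ≠ 0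
  let S₀ := Finset.univ.filter fun v => f v = 0
  let X := S.filter fun v => 2 * t + 1 ≤ rankWeight G f v
  let P₀ := S.filter fun v => rankWeight G f v = 2 * t ∧
    ∃ u, G.Adj v u ∧ f v < f u ∧ G.degree u ≤ 2 * t + 1
  let P₁ := S.filter fun v => rankWeight G f v = 2 * t ∧
    (∃ u, G.Adj v u ∧ f v < f u) ∧ ∀ u, G.Adj v u → f v < f u → 2 * t + 1 < G.degree u
  let T := S.filter fun v => rankWeight G f v = 2 * t ∧ ∀ u, G.Adj v u → f u < f v
  have hback : ∀ v ∈ S, rankWeight G f v = 2 * t →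
      ((G.neighborFinset v).filter fun u => f u < f v).card = t := by
    intro v hv h
    rcases hf v (by simpa [S] using hv) with h' | h'
    · omega
    · exact h'.2.1
  have hTdeg : ∀ v ∈ T, G.degree v = t := by
    intro v hv
    obtain ⟨hvS, hvw, hvu⟩ := Finset.mem_filter.1 hv
    rw [← hback v hvS hvw, Finset.filter_true_of_mem, card_neighborFinset_eq_degree]
    simpa using hvu
  obtain ⟨E, hE⟩ : ∃ E, E = ∑ v ∈ S, (rankWeight G f v - 2 * t) := ⟨_, rfl⟩
  have hcard : S₀.card + S.card = Fintype.card V :=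
    Finset.card_filter_add_card_filter_not (s := Finset.univ) (fun v => f v = 0)
  have hS₀ : S₀.card ≤ t * κ := hf0
  have hsum := sum_rankWeight_le G f
  have hE1 : E + 2 * t * Fintype.card V ≤ 2 * G.edgeFinset.card + 2 * t * (t * κ) := by
    have h1 : E + 2 * t * S.card = ∑ v ∈ S, rankWeight G f v := by
      rw [hE, mul_comm (2 * t) S.card, ← smul_eq_mul S.card, ← Finset.sum_const,
        ← Finset.sum_add_distrib]
      refine Finset.sum_congr rfl fun v hv => ?_
      have := hw v (by simpa [S] using hv)
      omega
    have h2 : ∑ v ∈ S, rankWeight G f v ≤ ∑ v, rankWeight G f v :=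
      Finset.sum_le_sum_of_subset (Finset.subset_univ _)
    have h3 : 2 * t * S₀.card ≤ 2 * t * (t * κ) := Nat.mul_le_mul_left _ hS₀
    rw [← hcard, mul_add]
    omega
  have hX : X.card ≤ E := by
    rw [hE, Finset.card_eq_sum_ones]
    calc ∑ v ∈ X, 1 ≤ ∑ v ∈ X, (rankWeight G f v - 2 * t) :=
          Finset.sum_le_sum fun v hv => by
            have := (Finset.mem_filter.1 hv).2
            omega
      _ ≤ _ := Finset.sum_le_sum_of_subset (Finset.filter_subset _ _)
  have hP₀ : P₀.card + 2 * t * Fintype.card V ≤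
      2 * G.edgeFinset.card + (2 * t * (t * κ + κ) + κ) := by
    let I : Finset (V × V) := Finset.univ.filter fun p => p.1 ∈ P₀ ∧ G.Adj p.1 p.2 ∧
      f p.1 < f p.2 ∧ G.degree p.2 ≤ 2 * t + 1
    let A : V → Finset V := fun v => (G.neighborFinset v).filter fun u => f u < f v
    have hI : ∀ p ∈ I, G.Adj p.1 p.2 ∧ (A p.1).card ≤ t ∧ G.degree p.2 ≤ 2 * t + 1 := by
      intro p hp
      simp only [I, Finset.mem_filter, Finset.mem_univ, true_and] at hp
      have h1 := Finset.mem_filter.1 hp.1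
      exact ⟨hp.2.1, (hback _ h1.1 h1.2.1).le, hp.2.2.2⟩
    obtain ⟨Q, hQc, hQ⟩ := hG.exists_card_le_forall_adj_notMem hr t (2 * t + 1) I A hI
      fun v x hx => by simpa using (Finset.mem_filter.1 hx).1
    rw [← hκ] at hQc
    let g : V → ℕ := fun v => if v ∈ Q then 0 else f v
    have hgf : ∀ v, g v ≤ f v := fun v => by
      simp only [g]
      split_ifs <;> omega
    have hgw : ∀ v ∈ S \ Q, 2 * t + (if v ∈ P₀ then 1 else 0) ≤ rankWeight G g v := by
      intro v hv
      rw [Finset.mem_sdiff] at hv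
      have hv0 : f v ≠ 0 := by simpa [S] using hv.1
      have hgv : g v = f v := if_neg hv.2
      have h1 := rankWeight_le_of_le G hv0 hgv hgf
      have h2 := hw v hv0
      split_ifs with hvP
      · obtain ⟨u, hu1, hu2, hu3⟩ := (Finset.mem_filter.1 hvP).2.2
        rcases hQ (v, u) (by simp [I, hvP, hu1, hu2, hu3]) with h | ⟨x, hxQ, hxv, hx⟩
        · exact absurd h hv.2
        · have hfx : f v ≤ f x := by
            by_contra h
            exact hx (Finset.mem_filter.2 ⟨by simpa using hxv, not_le.1 h⟩)
          have hgx : g x = 0 := if_pos hxQ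
          have h3 := rankWeight_lt_of_le G hv0 hgv hgf hxv hfx (by omega)
          omega
      · omega
    have h1 : ∑ v ∈ S \ Q, (2 * t + (if v ∈ P₀ then 1 else 0)) ≤ 2 * G.edgeFinset.card :=
      (Finset.sum_le_sum hgw).trans ((Finset.sum_le_sum_of_subset (Finset.subset_univ _)).trans
        (sum_rankWeight_le G g))
    rw [Finset.sum_add_distrib, Finset.sum_const, smul_eq_mul, ← Finset.card_filter] at h1
    have h2 : P₀.card ≤ ((S \ Q).filter fun v => v ∈ P₀).card + Q.card := by
      refine (Finset.card_le_card fun v hv => ?_).trans (Finset.card_union_le _ _)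
      by_cases hvQ : v ∈ Q
      · exact Finset.mem_union_right _ hvQ
      · exact Finset.mem_union_left _ (Finset.mem_filter.2
          ⟨Finset.mem_sdiff.2 ⟨(Finset.mem_filter.1 hv).1, hvQ⟩, hv⟩)
    have h3 : Fintype.card V ≤ (S \ Q).card + (t * κ + κ) := by
      have := Finset.card_le_card_sdiff_add_card (s := S) (t := Q)
      omega
    have h4 := Nat.mul_le_mul_left (2 * t) h3
    rw [mul_add, mul_comm _ (S \ Q).card] at h4
    omega
  have hP₁ : 2 * P₁.card ≤ 2 * t * P₀.card + (2 * t + 1) * E := by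
    let Z := S.filter fun v => 2 * t + 1 < G.degree v
    have hdouble := Finset.sum_card_bipartiteAbove_eq_sum_card_bipartiteBelow
      (s := P₁) (t := Z) (fun u x => G.Adj u x ∧ f u < f x)
    have hlow : ∀ u ∈ P₁, 2 + 2 * t * (if u ∈ Z then 1 else 0) ≤
        2 * (Finset.bipartiteAbove (fun u x => G.Adj u x ∧ f u < f x) Z u).card := by
      intro u hu
      obtain ⟨huS, huw, ⟨x, hux, hfx⟩, hhigh⟩ := Finset.mem_filter.1 hu
      have hmem : ∀ y, G.Adj u y → f u < f y →
          y ∈ Finset.bipartiteAbove (fun u x => G.Adj u x ∧ f u < f x) Z u := by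
        intro y huy hfy
        rw [Finset.mem_bipartiteAbove]
        have hy0 : f y ≠ 0 := by omega
        exact ⟨Finset.mem_filter.2 ⟨by simpa [S] using hy0, hhigh y huy hfy⟩, huy, hfy⟩
      split_ifs with huZ
      · have h1 := (Finset.mem_filter.1 huZ).2
        rw [← card_neighborFinset_eq_degree, ← Finset.card_filter_add_card_filter_not
          (s := G.neighborFinset u) (fun y => f y < f u), hback u huS huw] at h1
        have h2 : ((G.neighborFinset u).filter fun y => ¬ f y < f u).card ≤
            (Finset.bipartiteAbove (fun u x => G.Adj u x ∧ f u < f x) Z u).card := by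
          refine Finset.card_le_card fun y hy => ?_
          rw [Finset.mem_filter, mem_neighborFinset] at hy
          have h3 : f y ≠ f u := by
            rcases hf u (by simpa [S] using huS) with h | h
            · omega
            · exact h.2.2 y hy.1
          exact hmem y hy.1 (by omega)
        omega
      · have := Finset.card_pos.2 ⟨x, hmem x hux hfx⟩
        omega
    have hup : ∀ x ∈ Z, 2 * (Finset.bipartiteBelow (fun u x => G.Adj u x ∧ f u < f x) P₁ x).card ≤
        2 * t * (if x ∈ P₁ then 1 else 0) + 2 * t * (if x ∈ P₀ then 1 else 0) +
          (2 * t + 1) * (rankWeight G f x - 2 * t) := by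
      intro x hx
      obtain ⟨hxS, hxd⟩ := Finset.mem_filter.1 hx
      have hx0 : f x ≠ 0 := by simpa [S] using hxS
      have h1 : (Finset.bipartiteBelow (fun u x => G.Adj u x ∧ f u < f x) P₁ x).card ≤
          ((G.neighborFinset x).filter fun u => f u < f x).card := by
        refine Finset.card_le_card fun u hu => ?_
        rw [Finset.mem_bipartiteBelow] at hu
        simpa using ⟨hu.2.1.symm, hu.2.2⟩
      rcases hf x hx0 with h | ⟨h, h', h''⟩
      · have h2 : 2 * ((G.neighborFinset x).filter fun u => f u < f x).card ≤
            rankWeight G f x := by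
          rw [rankWeight, if_neg hx0]
          omega
        obtain ⟨z, hz⟩ : ∃ z, rankWeight G f x = 2 * t + (z + 1) :=
          ⟨rankWeight G f x - 2 * t - 1, by omega⟩
        rw [hz, Nat.add_sub_cancel_left]
        have h3 : (2 * t + 1) * (z + 1) = 2 * t * z + 2 * t + z + 1 := by ring
        omega
      · by_cases hP0 : x ∈ P₀
        · rw [if_pos hP0]
          omega
        · have hP1 : x ∈ P₁ := by
            refine Finset.mem_filter.2 ⟨hxS, h, ?_, ?_⟩
            · by_contra! hno
              have : x ∈ T := Finset.mem_filter.2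
                ⟨hxS, h, fun u hu => lt_of_le_of_ne (hno u hu) (h'' u hu)⟩
              have := hTdeg x this
              omega
            · intro u hu hfu
              by_contra! hlow
              exact hP0 (Finset.mem_filter.2 ⟨hxS, h, u, hu, hfu, hlow⟩)
          rw [if_pos hP1]
          omega
    have h1 := Finset.sum_le_sum hlow
    have h2 := Finset.sum_le_sum hup
    simp only [Finset.sum_add_distrib, ← Finset.mul_sum, Finset.sum_const, smul_eq_mul,
      ← Finset.card_filter] at h1 h2
    rw [hdouble] at h1
    have h3 : (Z.filter fun x => x ∈ P₁).card = (P₁.filter fun x => x ∈ Z).card := by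
      rw [Finset.filter_mem_eq_inter, Finset.filter_mem_eq_inter, Finset.inter_comm]
    have h4 : (Z.filter fun x => x ∈ P₀).card ≤ P₀.card :=
      Finset.card_le_card fun x hx => (Finset.mem_filter.1 hx).2
    have h5 : ∑ x ∈ Z, (rankWeight G f x - 2 * t) ≤ E := by
      rw [hE]
      exact Finset.sum_le_sum_of_subset (Finset.filter_subset _ _)
    have h6 := Nat.mul_le_mul_left (2 * t) h4
    have h7 := Nat.mul_le_mul_left (2 * t + 1) h5
    rw [h3] at h2
    omega
  refine ⟨T, fun v hv => ⟨hTdeg v hv, fun u hu huT => ?_⟩, ?_⟩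
  · have h1 := (Finset.mem_filter.1 hv).2.2 u hu
    have h2 := (Finset.mem_filter.1 huT).2.2 v hu.symm
    omega
  · have hcover : Tᶜ ⊆ S₀ ∪ X ∪ P₀ ∪ P₁ := by
      intro v hv
      by_contra hno
      simp only [Finset.mem_union, not_or] at hno
      obtain ⟨⟨⟨hv0, hvX⟩, hvP0⟩, hvP1⟩ := hno
      have hv0' : f v ≠ 0 := by simpa [S₀] using hv0
      have hvS : v ∈ S := by simpa [S] using hv0'
      rcases hf v hv0' with h | ⟨h, h', h''⟩
      · exact hvX (Finset.mem_filter.2 ⟨hvS, h⟩)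
      · refine Finset.mem_compl.1 hv (Finset.mem_filter.2 ⟨hvS, h, fun u hu => ?_⟩)
        by_contra! hfu
        refine hvP1 (Finset.mem_filter.2 ⟨hvS, h,
          ⟨u, hu, lt_of_le_of_ne hfu (h'' u hu).symm⟩, fun y hy hfy => ?_⟩)
        by_contra! hlow
        exact hvP0 (Finset.mem_filter.2 ⟨hvS, h, y, hy, hfy, hlow⟩)
    have h1 := Finset.card_le_card hcover
    have h2 := Finset.card_union_le (S₀ ∪ X ∪ P₀) P₁
    have h3 := Finset.card_union_le (S₀ ∪ X) P₀
    have h4 := Finset.card_union_le S₀ X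
    obtain ⟨B, hB⟩ : ∃ B, B = 2 * t * (t * κ + κ) + κ := ⟨_, rfl⟩
    obtain ⟨m, hm⟩ : ∃ m, m = 2 * t * Fintype.card V := ⟨_, rfl⟩
    rw [← hB, ← hm] at hP₀
    have hB' : 2 * t * (t * κ) ≤ B := by
      rw [hB, mul_add]
      omega
    rw [← hm] at hE1
    obtain ⟨Y, hY⟩ : ∃ Y, Y + m = 2 * G.edgeFinset.card + B :=
      ⟨2 * G.edgeFinset.card + B - m, by omega⟩
    have h5 : 2 * t * P₀.card ≤ 2 * t * Y := Nat.mul_le_mul_left _ (by omega)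
    have h6 : (2 * t + 1) * E ≤ (2 * t + 1) * Y := Nat.mul_le_mul_left _ (by omega)
    have h7 : Tᶜ.card ≤ (2 * t + 3) * Y + t * κ := by
      have h8 : (2 * t + 3) * Y = 2 * t * Y + 3 * Y := by ring
      have h9 : (2 * t + 1) * Y = 2 * t * Y + Y := by ring
      omega
    rw [← hB, ← hm]
    calc _ ≤ (2 * t + 3) * Y + t * κ + (2 * t + 3) * m := by omega
      _ = (2 * t + 3) * (Y + m) + t * κ := by ring
      _ = _ := by rw [hY]; ring

theorem ncard_neighborSet (G : SimpleGraph V) (v : V) : (G.neighborSet v).ncard = G.degree v := by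
  rw [← card_neighborFinset_eq_degree, ← Set.ncard_coe_finset, coe_neighborFinset]

theorem TwinCond.card_filter_le {G : SimpleGraph V} {t : ℕ} (hG : TwinCond G t) (ht : 1 ≤ t)
    (T S : Finset V) : (T.filter fun v => G.neighborFinset v = S).card ≤ t := by
  by_cases h : (T.filter fun v => G.neighborFinset v = S).card ≤ 1
  · omega
  obtain ⟨u, hu, v, hv, huv⟩ := Finset.one_lt_card.1 (not_le.1 h)
  rw [Finset.mem_filter] at hu hv
  have huv' : G.neighborSet u = G.neighborSet v := by
    rw [← Set.toFinset_inj]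
    exact hu.2.trans hv.2.symm
  obtain ⟨w, hw, hwu, -⟩ := hG u v huv huv'
  rw [ncard_neighborSet, ← card_neighborFinset_eq_degree] at hw
  rw [← hw]
  refine Finset.card_le_card fun x hx => ?_
  have hwx : w ∈ G.neighborFinset x := by
    rw [(Finset.mem_filter.1 hx).2, ← hu.2]
    simpa using hwu.symm
  simpa using ((mem_neighborFinset _ _ _).1 hwx).symm

theorem Ksat.card_leaves_le {r t : ℕ} (hr : 3 ≤ r) (hrt : r ≤ t) {G : SimpleGraph V}
    (hG : Ksat r G) (hGt : TwinCond G t) {T : Finset V}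
    (hT : ∀ v ∈ T, G.degree v = t ∧ ∀ u, G.Adj v u → u ∉ T) :
    T.card ≤ t * (2 ^ t * Tᶜ.card ^ (t - r + 2)) := by
  refine (Finset.card_le_mul_card_image (f := fun v => G.neighborFinset v) T t
    fun S _ => hGt.card_filter_le (by omega) T S).trans (Nat.mul_le_mul_left _ ?_)
  obtain rfl | ⟨v₀, hv₀⟩ := T.eq_empty_or_nonempty
  · simp
  have hsub : ∀ v ∈ T, ∃ I ⊆ G.neighborFinset v ∩ G.neighborFinset v₀, I.card = r - 2 := by
    intro v hv
    by_cases hvv : v = v₀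
    · refine Finset.exists_subset_card_eq ?_
      rw [hvv, Finset.inter_self, card_neighborFinset_eq_degree, (hT v₀ hv₀).1]
      omega
    · obtain ⟨s, hs, hs'⟩ := hG.exists_common_clique hvv fun h => (hT v hv).2 _ h hv₀
      exact ⟨s, fun x hx => by simpa using hs' x hx, hs.card_eq⟩
  have himage : T.image (fun v => G.neighborFinset v) ⊆
      ((G.neighborFinset v₀).powersetCard (r - 2) ×ˢ Tᶜ.powersetCard (t - r + 2)).image
        fun p => p.1 ∪ p.2 := by
    intro S hS
    obtain ⟨v, hv, rfl⟩ := Finset.mem_image.1 hS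
    obtain ⟨I, hI, hIc⟩ := hsub v hv
    rw [Finset.subset_inter_iff] at hI
    refine Finset.mem_image.2 ⟨(I, G.neighborFinset v \ I), Finset.mem_product.2
      ⟨Finset.mem_powersetCard.2 ⟨hI.2, hIc⟩, Finset.mem_powersetCard.2 ⟨fun x hx => ?_, ?_⟩⟩,
      Finset.union_sdiff_of_subset hI.1⟩
    · rw [Finset.mem_sdiff, mem_neighborFinset] at hx
      exact Finset.mem_compl.2 ((hT v hv).2 x hx.1)
    · rw [Finset.card_sdiff_of_subset hI.1, card_neighborFinset_eq_degree, (hT v hv).1, hIc]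
      omega
  refine (Finset.card_le_card himage).trans (Finset.card_image_le.trans ?_)
  rw [Finset.card_product, Finset.card_powersetCard, Finset.card_powersetCard,
    card_neighborFinset_eq_degree, (hT v₀ hv₀).1]
  exact Nat.mul_le_mul (Nat.choose_le_two_pow _ _) (Nat.choose_le_pow _ _)

theorem Ksat.card_edgeFinset_ge {r t : ℕ} (hr : 3 ≤ r) (hrt : r ≤ t) : ∃ A B D : ℕ,
    ∀ (V : Type*) [Fintype V] (G : SimpleGraph V), Ksat r G → MinDegGe G t → TwinCond G t →
    ∃ m, Fintype.card V ≤ D * m ^ (t - r + 2) ∧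
      m + A * (t * Fintype.card V) ≤ A * G.edgeSet.ncard + B := by
  obtain ⟨C, C', hC⟩ := Ksat.exists_leaves (r := r) (t := t) (by omega)
  refine ⟨2 * C, C', 1 + t * 2 ^ t, fun V _ G hG hdeg hGt => ?_⟩
  obtain ⟨T, hT, hle⟩ := hC V G hG fun v => by
    rw [← ncard_neighborSet]
    exact hdeg v
  refine ⟨Tᶜ.card, ?_, ?_⟩
  · have h1 := hG.card_leaves_le hr hrt hGt hT
    have h2 := Nat.le_self_pow (n := t - r + 2) (by omega) Tᶜ.card
    have h3 := Finset.card_add_card_compl T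
    rw [add_mul, one_mul, mul_assoc]
    omega
  · rw [← coe_edgeFinset, Set.ncard_coe_finset]
    calc _ = Tᶜ.card + C * (2 * t * Fintype.card V) := by ring
      _ ≤ _ := hle
      _ = _ := by ring

theorem exists_lower_bound {r t : ℕ} (hr : 3 ≤ r) (hrt : r ≤ t) : ∃ c : ℝ, 0 < c ∧ ∃ N : ℕ,
    ∀ (V : Type*) [Fintype V] (G : SimpleGraph V), N ≤ Fintype.card V → Ksat r G →
      MinDegGe G t → TwinCond G t →
      (t : ℝ) * Fintype.card V + c * (Fintype.card V : ℝ) ^ ((1 : ℝ) / ((t : ℝ) - r + 2)) ≤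
        (G.edgeSet.ncard : ℝ) := by
  obtain ⟨A, B, D, h⟩ := Ksat.card_edgeFinset_ge hr hrt
  obtain ⟨ℓ, hℓ⟩ : ∃ ℓ, ℓ = t - r + 2 := ⟨_, rfl⟩
  have hℓ' : (t : ℝ) - r + 2 = (ℓ : ℝ) := by
    rw [hℓ]
    push_cast [hrt]
    ring
  have hℓ0 : ℓ ≠ 0 := by omega
  rw [← hℓ] at h
  rw [hℓ']
  have hDA : (0 : ℝ) < 2 * (D + 1) * (A + 1) := by positivity
  refine ⟨1 / (2 * (D + 1) * (A + 1)), by positivity, D * (2 * B) ^ ℓ + 1,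
    fun V _ G hV hG hdeg hGt => ?_⟩
  obtain ⟨m, hm, hle⟩ := h V G hG hdeg hGt
  have hmB : 2 * B < m := by
    by_contra! hmB
    have := Nat.mul_le_mul_left D (Nat.pow_le_pow_left hmB ℓ)
    omega
  have hroot : (Fintype.card V : ℝ) ^ ((1 : ℝ) / ℓ) ≤ (D + 1) * m := by
    have h1 : (Fintype.card V : ℝ) ≤ ((D + 1) * m) ^ ℓ := by
      have h2 : (Fintype.card V : ℝ) ≤ D * m ^ ℓ := by exact_mod_cast hm
      have h3 : (D : ℝ) ≤ (D + 1) ^ ℓ := by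
        have := le_self_pow₀ (a := (D : ℝ) + 1) (by simp) hℓ0
        linarith
      rw [mul_pow]
      exact h2.trans (mul_le_mul_of_nonneg_right h3 (by positivity))
    calc _ ≤ (((D + 1) * m : ℝ) ^ ℓ) ^ ((1 : ℝ) / ℓ) :=
          Real.rpow_le_rpow (by positivity) h1 (by positivity)
      _ = _ := by
          rw [one_div, Real.pow_rpow_inv_natCast (by positivity) hℓ0]
  have hle' : (m : ℝ) + A * (t * Fintype.card V) ≤ A * G.edgeSet.ncard + B := by
    exact_mod_cast hle
  have hmB' : (2 : ℝ) * B ≤ m := by exact_mod_cast hmB.le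
  have hm2 : (m : ℝ) / 2 ≤ A * (G.edgeSet.ncard - t * Fintype.card V) := by linarith
  have hpos : (0 : ℝ) ≤ G.edgeSet.ncard - t * Fintype.card V := by
    by_contra! hneg
    have h1 : (A : ℝ) * (G.edgeSet.ncard - t * Fintype.card V) ≤ 0 :=
      mul_nonpos_of_nonneg_of_nonpos (by positivity) hneg.le
    have h2 : (0 : ℝ) < m := by exact_mod_cast (Nat.zero_le _).trans_lt hmB
    linarith
  have hm3 : (m : ℝ) ≤ 2 * (A + 1) * (G.edgeSet.ncard - t * Fintype.card V) := by linarith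
  have hfinal : 1 / (2 * (D + 1) * (A + 1)) * (Fintype.card V : ℝ) ^ ((1 : ℝ) / ℓ) ≤
      G.edgeSet.ncard - t * Fintype.card V := by
    rw [one_div, inv_mul_le_iff₀ hDA]
    calc _ ≤ ((D : ℝ) + 1) * m := hroot
      _ ≤ (D + 1) * (2 * (A + 1) * (G.edgeSet.ncard - t * Fintype.card V)) :=
          mul_le_mul_of_nonneg_left hm3 (by positivity)
      _ = _ := by ring
  linarith

end LowerBound

section UpperBound

theorem SimpleGraph.CliqueFree.exists_ksat {V : Type*} [Finite V] {r : ℕ} {G₀ : SimpleGraph V}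
    (h : G₀.CliqueFree r) : ∃ G, G₀ ≤ G ∧ Ksat r G := by
  obtain ⟨G, hle, hG⟩ := Finite.exists_le_maximal (p := fun G : SimpleGraph V => G.CliqueFree r) h
  refine ⟨G, hle, hG.prop, fun u v huv hadj hfree => hadj ?_⟩
  refine hG.le_of_ge hfree le_sup_left ?_
  simp [huv]

/-- The join of a complete graph on `d` vertices with the graph obtained from `H` by adding an
independent set `Φ` of new vertices, where the new vertex `φ` is joined to `S φ`. -/
def attachGraph (d : ℕ) {K Φ : Type*} (H : SimpleGraph K) (S : Φ → Finset K) :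
    SimpleGraph (Fin d ⊕ (K ⊕ Φ)) :=
  fromRel fun
    | .inl _, _ => True
    | .inr (.inl a), .inr (.inl b) => H.Adj a b
    | .inr (.inr φ), .inr (.inl a) => a ∈ S φ
    | _, _ => False

variable {d : ℕ} {K Φ : Type*} {H : SimpleGraph K} {S : Φ → Finset K}

@[simp] theorem attachGraph_adj_inl (i : Fin d) (x : Fin d ⊕ (K ⊕ Φ)) :
    (attachGraph d H S).Adj (.inl i) x ↔ .inl i ≠ x := by
  simp [attachGraph]

@[simp] theorem attachGraph_adj_old (a b : K) :
    (attachGraph d H S).Adj (.inr (.inl a)) (.inr (.inl b)) ↔ H.Adj a b := by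
  simp only [attachGraph, fromRel_adj, H.adj_comm b a, or_self, and_iff_right_iff_imp]
  rintro h heq
  exact h.ne (by simpa using heq)

@[simp] theorem attachGraph_adj_new_old (φ : Φ) (a : K) :
    (attachGraph d H S).Adj (.inr (.inr φ)) (.inr (.inl a)) ↔ a ∈ S φ := by
  simp [attachGraph]

@[simp] theorem attachGraph_adj_old_new (φ : Φ) (a : K) :
    (attachGraph d H S).Adj (.inr (.inl a)) (.inr (.inr φ)) ↔ a ∈ S φ := by
  simp [attachGraph]

@[simp] theorem attachGraph_adj_new (φ ψ : Φ) :
    ¬ (attachGraph d H S).Adj (.inr (.inr φ)) (.inr (.inr ψ)) := by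
  simp [attachGraph]

theorem attachGraph_cliqueFree (hH : ∀ a b c, H.Adj a b → H.Adj b c → ¬ H.Adj a c)
    (hS : ∀ φ, ∀ a ∈ S φ, ∀ b ∈ S φ, ¬ H.Adj a b) : (attachGraph d H S).CliqueFree (d + 3) := by
  intro s hs
  have h1 : s.toLeft.card ≤ d := (Finset.card_le_univ _).trans (by simp)
  have h2 : 2 < s.toRight.card := by
    have := s.card_toLeft_add_card_toRight
    rw [hs.card_eq] at this
    omega
  obtain ⟨x, hx, y, hy, z, hz, hxy, hxz, hyz⟩ := Finset.two_lt_card.1 h2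
  rw [Finset.mem_toRight] at hx hy hz
  have hxy' := hs.isClique hx hy (by simpa using hxy)
  have hxz' := hs.isClique hx hz (by simpa using hxz)
  have hyz' := hs.isClique hy hz (by simpa using hyz)
  rcases x with a | φ <;> rcases y with b | ψ <;> rcases z with c | χ <;>
    simp only [attachGraph_adj_old, attachGraph_adj_new_old, attachGraph_adj_old_new,
      attachGraph_adj_new] at hxy' hxz' hyz'
  · exact hH a b c hxy' hyz' hxz'
  · exact hS _ _ hxz' _ hyz' hxy'
  · exact hS _ _ hxy' _ hyz' hxz'
  · exact hS _ _ hxy' _ hxz' hyz'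

theorem not_triangle_of_attachGraph_le {G : SimpleGraph (Fin d ⊕ (K ⊕ Φ))}
    (hle : attachGraph d H S ≤ G) (hG : G.CliqueFree (d + 3)) {x y z : K ⊕ Φ}
    (hxy : G.Adj (.inr x) (.inr y)) (hxz : G.Adj (.inr x) (.inr z)) :
    ¬ G.Adj (.inr y) (.inr z) := by
  classical
  intro hyz
  have hxy0 : x ≠ y := by simpa using hxy.ne
  have hxz0 : x ≠ z := by simpa using hxz.ne
  have hyz0 : y ≠ z := by simpa using hyz.ne
  refine hG ((Finset.univ : Finset (Fin d)).disjSum {x, y, z}) ⟨?_, ?_⟩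
  · rintro (i | u) hu (j | v) hv huv
    · exact hle (by simpa using huv)
    · exact hle (by simp)
    · exact (hle (by simp : (attachGraph d H S).Adj (.inl j) (.inr u))).symm
    · simp only [Finset.mem_coe, Finset.inr_mem_disjSum, Finset.mem_insert,
        Finset.mem_singleton] at hu hv
      rcases hu with rfl | rfl | rfl <;> rcases hv with rfl | rfl | rfl <;>
        first | exact absurd rfl huv | assumption | (apply SimpleGraph.Adj.symm; assumption)
  · rw [Finset.card_disjSum, Finset.card_univ, Fintype.card_fin,
      Finset.card_eq_three.2 ⟨x, y, z, hxy0, hxz0, hyz0, rfl⟩]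

theorem neighborSet_of_attachGraph_le {G : SimpleGraph (Fin d ⊕ (K ⊕ Φ))}
    (hle : attachGraph d H S ≤ G) (hG : G.CliqueFree (d + 3))
    (hSd : ∀ φ, ∀ k ∉ S φ, ∃ s ∈ S φ, H.Adj k s) (hSS : ∀ φ ψ, ∃ s ∈ S φ, s ∈ S ψ) (φ : Φ) :
    G.neighborSet (.inr (.inr φ)) =
      ((Finset.univ : Finset (Fin d)).disjSum ((S φ).disjSum (∅ : Finset Φ)) : Set _) := by
  ext x
  rw [mem_neighborSet, Finset.mem_coe]
  rcases x with i | k | ψ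
  · simpa using (hle (by simp : (attachGraph d H S).Adj (.inl i) (.inr (.inr φ)))).symm
  · simp only [Finset.inr_mem_disjSum, Finset.inl_mem_disjSum]
    refine ⟨fun h => ?_, fun h => hle (by simpa using h)⟩
    by_contra hk
    obtain ⟨s, hs, hks⟩ := hSd φ k hk
    exact not_triangle_of_attachGraph_le hle hG h
      (hle (by simpa using hs) : G.Adj _ (.inr (.inl s))) (hle (by simpa using hks))
  · simp only [Finset.inr_mem_disjSum, Finset.notMem_empty, iff_false]
    intro h
    obtain ⟨s, hs, hs'⟩ := hSS φ ψ
    exact not_triangle_of_attachGraph_le hle hG h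
      (hle (by simpa using hs) : G.Adj _ (.inr (.inl s))) (hle (by simpa using hs'))

theorem exists_ksat_of_attachGraph {t : ℕ} [Fintype K] [Fintype Φ] [Nonempty K] (ht : t ≠ 0)
    (hH : ∀ a b c, H.Adj a b → H.Adj b c → ¬ H.Adj a c)
    (hSi : ∀ φ, ∀ a ∈ S φ, ∀ b ∈ S φ, ¬ H.Adj a b)
    (hSd : ∀ φ, ∀ k ∉ S φ, ∃ s ∈ S φ, H.Adj k s) (hSS : ∀ φ ψ, ∃ s ∈ S φ, s ∈ S ψ)
    (hSinj : Function.Injective S) (hSc : ∀ φ, d + (S φ).card = t)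
    (hdeg : ∀ k, ∃ A : Finset Φ, t ≤ A.card ∧ ∀ φ ∈ A, k ∈ S φ) :
    ∃ G : SimpleGraph (Fin d ⊕ (K ⊕ Φ)), Ksat (d + 3) G ∧ MinDegGe G t ∧ TwinCond G t ∧
      G.edgeSet.ncard ≤ t * Fintype.card Φ + (d + Fintype.card K) ^ 2 := by
  classical
  obtain ⟨G, hle, hG⟩ := (attachGraph_cliqueFree (d := d) hH hSi).exists_ksat
  let N : Φ → Finset (Fin d ⊕ (K ⊕ Φ)) := fun φ => Finset.univ.disjSum ((S φ).disjSum ∅)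
  have hN : ∀ φ, G.neighborSet (.inr (.inr φ)) = N φ :=
    neighborSet_of_attachGraph_le hle hG.1 hSd hSS
  have hNc : ∀ φ, (N φ).card = t := fun φ => by simp [N, hSc]
  have hNc' : ∀ φ, (G.neighborSet (.inr (.inr φ))).ncard = t := fun φ => by
    rw [hN, Set.ncard_coe_finset, hNc]
  have hdeg' : ∀ x : Fin d ⊕ K, ∃ A : Finset Φ, t ≤ A.card ∧
      ∀ φ ∈ A, G.Adj (.inr (.inr φ)) (x.map id .inl) := by
    rintro (i | k)
    · obtain ⟨A, hA, -⟩ := hdeg (Classical.arbitrary K)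
      exact ⟨A, hA, fun φ _ => (hle (by simp :
        (attachGraph d H S).Adj (.inl i) (.inr (.inr φ)))).symm⟩
    · obtain ⟨A, hA, hA'⟩ := hdeg k
      exact ⟨A, hA, fun φ hφ => hle (by simpa using hA' φ hφ)⟩
  have hcases : ∀ x : Fin d ⊕ (K ⊕ Φ), (∃ φ, x = .inr (.inr φ)) ∨
      ∃ y : Fin d ⊕ K, x = y.map id .inl := by
    rintro (i | k | φ)
    · exact Or.inr ⟨.inl i, rfl⟩
    · exact Or.inr ⟨.inr k, rfl⟩
    · exact Or.inl ⟨φ, rfl⟩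
  have htwin : ∀ (x : Fin d ⊕ K) v, G.neighborSet (x.map id .inl) = G.neighborSet v →
      ∃ w, (G.neighborSet w).ncard = t ∧ G.Adj w (x.map id .inl) ∧ G.Adj w v := by
    intro x v hxv
    obtain ⟨A, hA, hA'⟩ := hdeg' x
    obtain ⟨φ, hφ⟩ := Finset.card_pos.1 ((Nat.pos_of_ne_zero ht).trans_le hA)
    refine ⟨_, hNc' φ, hA' φ hφ, ?_⟩
    have : .inr (.inr φ) ∈ G.neighborSet v := hxv ▸ (hA' φ hφ).symm
    exact this.symm
  refine ⟨G, hG, fun v => ?_, fun u v huv h => ?_, ?_⟩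
  · obtain ⟨φ, rfl⟩ | ⟨x, rfl⟩ := hcases v
    · exact (hNc' φ).ge
    · obtain ⟨A, hA, hA'⟩ := hdeg' x
      have hsub : ((A.map ⟨fun φ => (.inr (.inr φ) : Fin d ⊕ (K ⊕ Φ)), fun _ _ => by simp⟩ :
          Finset _) : Set _) ⊆ G.neighborSet (x.map id .inl) := by
        intro y hy
        obtain ⟨φ, hφ, rfl⟩ := Finset.mem_map.1 (Finset.mem_coe.1 hy)
        exact (hA' φ hφ).symm
      have := Set.ncard_le_ncard hsub
      rw [Set.ncard_coe_finset, Finset.card_map] at this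
      exact hA.trans this
  · obtain ⟨φ, rfl⟩ | ⟨x, rfl⟩ := hcases u
    · obtain ⟨ψ, rfl⟩ | ⟨x, rfl⟩ := hcases v
      · rw [hN, hN, Finset.coe_inj] at h
        refine absurd (congrArg _ (congrArg _ (hSinj ?_))) huv
        ext k
        simpa [N] using Finset.ext_iff.1 h (.inr (.inl k))
      · obtain ⟨w, hw, h1, h2⟩ := htwin x _ h.symm
        exact ⟨w, hw, h2, h1⟩
    · exact htwin x v h
  · have hsub : G.edgeSet ⊆ (((Finset.univ.sigma N).image fun p => s(.inr (.inr p.1), p.2)) ∪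
        (Finset.univ : Finset ((Fin d ⊕ K) × (Fin d ⊕ K))).image
          fun p => s(p.1.map id .inl, p.2.map id .inl) : Finset (Sym2 (Fin d ⊕ (K ⊕ Φ)))) := by
      intro e
      induction e with | _ u v
      intro he
      have hadj : G.Adj u v := he
      rw [Finset.mem_coe, Finset.mem_union, Finset.mem_image, Finset.mem_image]
      have hnew : ∀ φ y, G.Adj (.inr (.inr φ)) y → (⟨φ, y⟩ : Σ _, _) ∈ Finset.univ.sigma N := by
        intro φ y hy
        rw [← mem_neighborSet, hN] at hy
        exact Finset.mem_sigma.2 ⟨Finset.mem_univ _, hy⟩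
      obtain ⟨φ, rfl⟩ | ⟨x, rfl⟩ := hcases u
      · exact Or.inl ⟨⟨φ, v⟩, hnew φ v hadj, rfl⟩
      · obtain ⟨φ, rfl⟩ | ⟨y, rfl⟩ := hcases v
        · exact Or.inl ⟨⟨φ, _⟩, hnew φ _ hadj.symm, Sym2.eq_swap⟩
        · exact Or.inr ⟨(x, y), Finset.mem_univ _, rfl⟩
    refine (Set.ncard_le_ncard hsub).trans ?_
    rw [Set.ncard_coe_finset]
    refine (Finset.card_union_le _ _).trans (add_le_add (Finset.card_image_le.trans ?_)
      (Finset.card_image_le.trans ?_))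
    · rw [Finset.card_sigma, Finset.sum_congr rfl fun φ _ => hNc φ, Finset.sum_const,
        smul_eq_mul, mul_comm, Finset.card_univ]
    · rw [Finset.card_univ, Fintype.card_prod, Fintype.card_sum, Fintype.card_fin, sq]

/-- Values at two cyclically consecutive positions of a function `ZMod ℓ → Fin q`, together with
one isolated vertex; two such records are adjacent when they contradict each other at a position
where one ends and the other begins. -/
def windowGraph (ℓ q : ℕ) : SimpleGraph (Option (ZMod ℓ × Fin q × Fin q)) :=
  fromRel fun
    | some (j, _, b), some (j', b', _) => j' = j + 1 ∧ b ≠ b'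
    | _, _ => False

/-- The windows of a function, together with the isolated vertex. -/
def windows {ℓ q : ℕ} [NeZero ℓ] (f : ZMod ℓ → Fin q) :
    Finset (Option (ZMod ℓ × Fin q × Fin q)) :=
  Finset.insertNone (Finset.univ.image fun j => (j, f j, f (j + 1)))

section windows
variable {ℓ q : ℕ}

theorem windowGraph_not_triangle (hℓ : 4 ≤ ℓ) (x y z : Option (ZMod ℓ × Fin q × Fin q))
    (hxy : (windowGraph ℓ q).Adj x y) (hyz : (windowGraph ℓ q).Adj y z) :
    ¬ (windowGraph ℓ q).Adj x z := by
  intro hxz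
  have h1 : (1 : ZMod ℓ) ≠ 0 := by
    have := (ZMod.natCast_eq_zero_iff 1 ℓ).not.2 fun h => by
      have := Nat.le_of_dvd (by omega) h
      omega
    exact_mod_cast this
  have h3 : (3 : ZMod ℓ) ≠ 0 := by
    have := (ZMod.natCast_eq_zero_iff 3 ℓ).not.2 fun h => by
      have := Nat.le_of_dvd (by omega) h
      omega
    exact_mod_cast this
  rcases x with _ | ⟨i, a, b⟩ <;> rcases y with _ | ⟨j, a', b'⟩ <;>
    rcases z with _ | ⟨k, a'', b''⟩ <;>
    simp only [windowGraph, fromRel_adj, or_self, and_false] at hxy hyz hxz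
  rcases hxy.2 with ⟨hxy, -⟩ | ⟨hxy, -⟩ <;> rcases hyz.2 with ⟨hyz, -⟩ | ⟨hyz, -⟩ <;>
    rcases hxz.2 with ⟨hxz, -⟩ | ⟨hxz, -⟩ <;>
    first
    | exact h1 (by linear_combination hxy + hyz - hxz)
    | exact h1 (by linear_combination hxz - hxy - hyz)
    | exact h1 (by linear_combination hxy - hyz - hxz)
    | exact h1 (by linear_combination hyz + hxz - hxy)
    | exact h1 (by linear_combination hyz - hxy - hxz)
    | exact h1 (by linear_combination hxy + hxz - hyz)
    | exact h3 (by linear_combination - hxy - hyz - hxz)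

/-- The function with prescribed values at two consecutive positions and constant elsewhere. -/
def windowFun (p : ZMod ℓ × Fin q × Fin q × Fin q) : ZMod ℓ → Fin q :=
  Function.update (Function.update (fun _ => p.2.2.2) p.1 p.2.1) (p.1 + 1) p.2.2.1

theorem windowFun_injective (hℓ : 3 ≤ ℓ) (j : ZMod ℓ) (a b : Fin q) :
    Function.Injective fun c => windowFun (j, a, b, c) := by
  intro c c' h
  have : Fact (1 < ℓ) := ⟨by omega⟩
  have h2 : (2 : ZMod ℓ) ≠ 0 := by
    have := (ZMod.natCast_eq_zero_iff 2 ℓ).not.2 fun h => by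
      have := Nat.le_of_dvd (by omega) h
      omega
    exact_mod_cast this
  have h3 : j + 2 ≠ j + 1 := fun h => one_ne_zero (by linear_combination h : (1 : ZMod ℓ) = 0)
  have := congrFun h (j + 2)
  simpa [windowFun, Function.update_apply, h2, h3] using this

variable [NeZero ℓ]

@[simp] theorem none_mem_windows (f : ZMod ℓ → Fin q) : none ∈ windows f := by
  simp [windows]

@[simp] theorem some_mem_windows (f : ZMod ℓ → Fin q) (j : ZMod ℓ) (a b : Fin q) :
    some (j, a, b) ∈ windows f ↔ f j = a ∧ f (j + 1) = b := by
  simp [windows]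

theorem card_windows (f : ZMod ℓ → Fin q) : (windows f).card = ℓ + 1 := by
  rw [windows, Finset.card_insertNone, Finset.card_image_of_injective, Finset.card_univ, ZMod.card]
  exact fun i j h => congrArg Prod.fst h

theorem windows_injective : Function.Injective (windows : (ZMod ℓ → Fin q) → _) := by
  intro f g h
  ext1 j
  have : some (j, f j, f (j + 1)) ∈ windows g := h ▸ by simp
  exact ((some_mem_windows _ _ _ _).1 this).1.symm

theorem windows_independent (f : ZMod ℓ → Fin q) :
    ∀ x ∈ windows f, ∀ y ∈ windows f, ¬ (windowGraph ℓ q).Adj x y := by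
  rintro (_ | ⟨i, a, b⟩) hx (_ | ⟨j, a', b'⟩) hy h <;>
    simp only [windowGraph, fromRel_adj, or_self, and_false] at h
  rw [some_mem_windows] at hx hy
  obtain ⟨rfl, rfl⟩ := hx
  obtain ⟨rfl, rfl⟩ := hy
  rcases h.2 with ⟨rfl, h⟩ | ⟨rfl, h⟩ <;> exact h rfl

theorem windows_dominating (hℓ : 2 ≤ ℓ) (f : ZMod ℓ → Fin q) :
    ∀ x ∉ windows f, ∃ y ∈ windows f, (windowGraph ℓ q).Adj x y := by
  have : Fact (1 < ℓ) := ⟨hℓ⟩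
  rintro (_ | ⟨j, a, b⟩) hx
  · simp at hx
  · rw [some_mem_windows, not_and_or] at hx
    rcases hx with hx | hx
    · refine ⟨some (j - 1, f (j - 1), f j), by simp, ?_⟩
      have hj : j ≠ j - 1 := fun h => one_ne_zero (by linear_combination h : (1 : ZMod ℓ) = 0)
      simp [windowGraph, hx, hj]
    · refine ⟨some (j + 1, f (j + 1), f (j + 1 + 1)), by simp, ?_⟩
      simp [windowGraph, Ne.symm hx]

theorem mem_windows_windowFun (hℓ : 2 ≤ ℓ) (j : ZMod ℓ) (a b c : Fin q) :
    some (j, a, b) ∈ windows (windowFun (j, a, b, c)) := by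
  have : Fact (1 < ℓ) := ⟨hℓ⟩
  simp [windowFun]

theorem exists_ksat_of_windows {d t M : ℕ} (hℓ : 4 ≤ ℓ) (ht : d + (ℓ + 1) = t) (hq : t ≤ q)
    (hM : ℓ * q ^ 3 ≤ M) (hM' : M ≤ q ^ ℓ) :
    ∃ (V : Type) (_ : Fintype V) (G : SimpleGraph V),
      Fintype.card V = d + (ℓ * q ^ 2 + 1) + M ∧ Ksat (d + 3) G ∧ MinDegGe G t ∧ TwinCond G t ∧
      G.edgeSet.ncard ≤ t * M + (d + (ℓ * q ^ 2 + 1)) ^ 2 := by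
  classical
  obtain ⟨F, hF, -, hFc⟩ := Finset.exists_subsuperset_card_eq
    (s := Finset.univ.image (windowFun : _ → ZMod ℓ → Fin q)) (t := Finset.univ) (n := M)
    (Finset.subset_univ _)
    (Finset.card_image_le.trans (by simpa [pow_succ, mul_assoc] using hM))
    (by simpa using hM')
  have hmem : ∀ p, windowFun p ∈ F := fun p => hF (Finset.mem_image_of_mem _ (Finset.mem_univ p))
  have hK : Fintype.card (Option (ZMod ℓ × Fin q × Fin q)) = ℓ * q ^ 2 + 1 := by
    simp [sq]
  have hsome : ∀ (j : ZMod ℓ) (a b : Fin q), ∃ A : Finset F, t ≤ A.card ∧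
      ∀ φ ∈ A, some (j, a, b) ∈ windows φ.1 := by
    intro j a b
    refine ⟨Finset.univ.map ⟨fun c => ⟨windowFun (j, a, b, c), hmem _⟩, fun c c' h =>
      windowFun_injective (by omega) j a b (Subtype.ext_iff.1 h)⟩, by simpa using hq, ?_⟩
    intro φ hφ
    obtain ⟨c, -, rfl⟩ := Finset.mem_map.1 hφ
    exact mem_windows_windowFun (by omega) j a b c
  have hdeg : ∀ k, ∃ A : Finset F, t ≤ A.card ∧ ∀ φ ∈ A, k ∈ windows φ.1 := by
    rintro (_ | ⟨j, a, b⟩)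
    · have a : Fin q := ⟨0, by omega⟩
      obtain ⟨A, hA, -⟩ := hsome 0 a a
      exact ⟨A, hA, fun φ _ => none_mem_windows _⟩
    · exact hsome j a b
  obtain ⟨G, h1, h2, h3, h4⟩ := exists_ksat_of_attachGraph (d := d) (t := t)
    (S := fun φ : F => windows φ.1) (by omega)
    (windowGraph_not_triangle hℓ) (fun φ => windows_independent φ.1)
    (fun φ => windows_dominating (by omega) φ.1)
    (fun φ ψ => ⟨none, none_mem_windows _, none_mem_windows _⟩)
    (windows_injective.comp Subtype.val_injective)
    (fun φ => by rw [card_windows, ht]) hdeg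
  refine ⟨_, inferInstance, G, ?_, h1, h2, h3, ?_⟩
  · rw [Fintype.card_sum, Fintype.card_sum, hK, Fintype.card_fin, Fintype.card_coe, hFc]
    ring
  · rwa [hK, Fintype.card_coe, hFc] at h4

end windows

section transport
variable {V W : Type*} {r t : ℕ} {G : SimpleGraph V}

theorem Ksat.comap_equiv (hG : Ksat r G) (e : W ≃ V) : Ksat r (G.comap e) := by
  refine ⟨hG.1.comap ⟨(SimpleGraph.Embedding.comap e.toEmbedding G).toCopy⟩,
    fun u v huv hadj hfree => ?_⟩
  let f : G ⊔ fromEdgeSet {s(e u, e v)} ↪g G.comap e ⊔ fromEdgeSet {s(u, v)} :=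
    ⟨e.symm.toEmbedding, by simp [Equiv.symm_apply_eq]⟩
  exact hG.2 (e u) (e v) (e.injective.ne huv) hadj (hfree.comap ⟨f.toCopy⟩)

theorem ncard_neighborSet_comap_equiv (G : SimpleGraph V) (e : W ≃ V) (w : W) :
    ((G.comap e).neighborSet w).ncard = (G.neighborSet (e w)).ncard := by
  rw [show (G.comap e).neighborSet w = e ⁻¹' G.neighborSet (e w) from rfl,
    Set.ncard_preimage_of_injective_subset_range e.injective (by simp)]

theorem MinDegGe.comap_equiv (hG : MinDegGe G t) (e : W ≃ V) : MinDegGe (G.comap e) t :=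
  fun w => (hG (e w)).trans_eq (ncard_neighborSet_comap_equiv G e w).symm

theorem TwinCond.comap_equiv (hG : TwinCond G t) (e : W ≃ V) : TwinCond (G.comap e) t := by
  intro u v huv h
  obtain ⟨w, hw, hwu, hwv⟩ := hG (e u) (e v) (e.injective.ne huv)
    (Set.preimage_injective.2 e.surjective h)
  refine ⟨e.symm w, ?_, by simpa using hwu, by simpa using hwv⟩
  rw [ncard_neighborSet_comap_equiv, e.apply_symm_apply, hw]

theorem ncard_edgeSet_comap_equiv (G : SimpleGraph V) (e : W ≃ V) :
    (G.comap e).edgeSet.ncard = G.edgeSet.ncard := by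
  rw [← Nat.card_coe_set_eq, ← Nat.card_coe_set_eq]
  exact Nat.card_congr (SimpleGraph.Iso.comap e G).mapEdgeSet

end transport

theorem exists_ksat_edgeSet_ncard_le {d ℓ t : ℕ} (hℓ : 5 ≤ ℓ) (ht : d + (ℓ + 1) = t) :
    ∃ A N : ℕ, 0 < A ∧ ∀ n, N ≤ n → ∃ p, p ^ ℓ ≤ n ∧ ∃ G : SimpleGraph (Fin n),
      Ksat (d + 3) G ∧ MinDegGe G t ∧ TwinCond G t ∧ G.edgeSet.ncard ≤ t * n + A * p ^ 4 := by
  have : NeZero ℓ := ⟨by omega⟩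
  refine ⟨(d + 4 * ℓ + 1) ^ 2, (12 * ℓ + d + 1 + t + 1) ^ ℓ + 1, by positivity, fun n hn => ?_⟩
  have hex : ∃ q, n ≤ q ^ ℓ := ⟨n, Nat.le_self_pow (by omega) n⟩
  obtain ⟨p, hpn, hnp⟩ : ∃ p, p ^ ℓ < n ∧ n ≤ (p + 1) ^ ℓ := by
    obtain ⟨q, hq, hmin⟩ : ∃ q, n ≤ q ^ ℓ ∧ ∀ p < q, ¬ n ≤ p ^ ℓ :=
      ⟨Nat.find hex, Nat.find_spec hex, fun p hp => Nat.find_min hex hp⟩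
    obtain _ | p := q
    · rw [zero_pow (by omega)] at hq
      omega
    · exact ⟨p, not_le.1 (hmin p (by omega)), hq⟩
  have hp : 12 * ℓ + d + 1 + t < p := by
    have := lt_of_pow_lt_pow_left₀ ℓ (Nat.zero_le _) ((Nat.lt_of_succ_le hn).trans_le hnp)
    omega
  have hq2 : (p + 1) ^ 2 ≤ 4 * p ^ 2 := by nlinarith
  have hq3 : (p + 1) ^ 3 ≤ 8 * p ^ 3 := by
    calc (p + 1) ^ 3 ≤ (2 * p) ^ 3 := Nat.pow_le_pow_left (by omega) 3
      _ = _ := by ring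
  have hp12 : 1 ≤ p ^ 2 := Nat.one_le_pow _ _ (by omega)
  have hcore : d + (ℓ * (p + 1) ^ 2 + 1) ≤ (d + 4 * ℓ + 1) * p ^ 2 := by
    have h1 := Nat.mul_le_mul_left ℓ hq2
    have h2 := Nat.mul_le_mul_left (d + 1) hp12
    calc _ = ℓ * (p + 1) ^ 2 + (d + 1) * 1 := by ring
      _ ≤ ℓ * (4 * p ^ 2) + (d + 1) * p ^ 2 := add_le_add h1 h2
      _ = _ := by ring
  have hlarge : ℓ * (p + 1) ^ 3 + (d + (ℓ * (p + 1) ^ 2 + 1)) ≤ n := by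
    have h1 : p ^ 2 ≤ p ^ 3 := Nat.pow_le_pow_right (by omega) (by omega)
    have h2 : 12 * ℓ + d + 1 ≤ p ^ 2 := by nlinarith
    calc _ ≤ ℓ * (8 * p ^ 3) + (d + 4 * ℓ + 1) * p ^ 3 :=
          add_le_add (Nat.mul_le_mul_left _ hq3) (hcore.trans (Nat.mul_le_mul_left _ h1))
      _ = (12 * ℓ + d + 1) * p ^ 3 := by ring
      _ ≤ p ^ 2 * p ^ 3 := Nat.mul_le_mul_right _ h2
      _ = p ^ 5 := by ring
      _ ≤ p ^ ℓ := Nat.pow_le_pow_right (by omega) hℓ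
      _ ≤ n := hpn.le
  obtain ⟨M, hM⟩ : ∃ M, M + (d + (ℓ * (p + 1) ^ 2 + 1)) = n :=
    ⟨n - (d + (ℓ * (p + 1) ^ 2 + 1)), by omega⟩
  obtain ⟨V, _, G, hc, h1, h2, h3, h4⟩ := exists_ksat_of_windows (d := d) (ℓ := ℓ) (q := p + 1)
    (t := t) (M := M) (by omega) ht (by omega) (by omega) (by omega)
  have e : Fin n ≃ V := (Fintype.equivFinOfCardEq (by omega)).symm
  refine ⟨p, hpn.le, G.comap e, h1.comap_equiv e, h2.comap_equiv e, h3.comap_equiv e, ?_⟩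
  rw [ncard_edgeSet_comap_equiv]
  calc _ ≤ t * M + (d + (ℓ * (p + 1) ^ 2 + 1)) ^ 2 := h4
    _ ≤ t * n + ((d + 4 * ℓ + 1) * p ^ 2) ^ 2 :=
        add_le_add (Nat.mul_le_mul_left _ (by omega)) (Nat.pow_le_pow_left hcore 2)
    _ = _ := by ring

theorem exists_upper_bound {r t : ℕ} (hr : 3 ≤ r) (ht : r + 3 ≤ t) : ∃ C : ℝ, 0 < C ∧ ∃ N : ℕ,
    ∀ n, N ≤ n → ∃ G : SimpleGraph (Fin n), Ksat r G ∧ MinDegGe G t ∧ TwinCond G t ∧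
      (G.edgeSet.ncard : ℝ) ≤ (t : ℝ) * n + C * (n : ℝ) ^ ((4 : ℝ) / ((t : ℝ) - r + 2)) := by
  obtain ⟨d, rfl⟩ : ∃ d, r = d + 3 := ⟨r - 3, by omega⟩
  obtain ⟨ℓ, hℓ⟩ : ∃ ℓ, t = d + (ℓ + 1) := ⟨t - d - 1, by omega⟩
  obtain ⟨A, N, hA, h⟩ := exists_ksat_edgeSet_ncard_le (d := d) (ℓ := ℓ) (by omega) hℓ.symm
  refine ⟨A, by exact_mod_cast hA, N, fun n hn => ?_⟩
  obtain ⟨p, hp, G, h1, h2, h3, h4⟩ := h n hn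
  refine ⟨G, h1, h2, h3, ?_⟩
  have hℓ' : (t : ℝ) - ((d + 3 : ℕ) : ℝ) + 2 = ℓ := by
    rw [hℓ]
    push_cast
    ring
  have hℓ0 : ℓ ≠ 0 := by omega
  have hroot : (p : ℝ) ^ 4 ≤ (n : ℝ) ^ ((4 : ℝ) / ℓ) := by
    calc (p : ℝ) ^ 4 = (((p : ℝ) ^ ℓ) ^ ((ℓ : ℝ)⁻¹)) ^ 4 := by
          rw [Real.pow_rpow_inv_natCast (by positivity) hℓ0]
      _ = ((p : ℝ) ^ ℓ) ^ ((4 : ℝ) / ℓ) := by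
          rw [← Real.rpow_mul_natCast (by positivity)]
          congr 1
          push_cast
          ring
      _ ≤ _ := Real.rpow_le_rpow (by positivity) (by exact_mod_cast hp) (by positivity)
  rw [hℓ']
  calc (G.edgeSet.ncard : ℝ) ≤ t * n + A * (p : ℝ) ^ 4 := by exact_mod_cast h4
    _ ≤ _ := by
        have := mul_le_mul_of_nonneg_left hroot (Nat.cast_nonneg (α := ℝ) A)
        linarith

end UpperBound

/-- For `r ≥ 3`, `t ≥ r+3`:
`tn + Ω(n^{1/(t-r+2)}) ≤ tsat(n, K_r, t) ≤ tn + O(n^{4/(t-r+2)})`. -/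
theorem stmt3 (r t : ℕ) (hr : 3 ≤ r) (ht : r + 3 ≤ t) :
    ∃ c C : ℝ, 0 < c ∧ 0 < C ∧ ∃ N : ℕ, ∀ n : ℕ, N ≤ n →
      (∀ (V : Type) [Fintype V] (G : SimpleGraph V), Fintype.card V = n →
        Ksat r G → MinDegGe G t → TwinCond G t →
        (t : ℝ) * n + c * (n : ℝ) ^ ((1 : ℝ) / ((t : ℝ) - r + 2)) ≤ (G.edgeSet.ncard : ℝ)) ∧
      (∃ G : SimpleGraph (Fin n), Ksat r G ∧ MinDegGe G t ∧ TwinCond G t ∧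
        (G.edgeSet.ncard : ℝ) ≤ (t : ℝ) * n + C * (n : ℝ) ^ ((4 : ℝ) / ((t : ℝ) - r + 2))) := by
  obtain ⟨c, hc, N₁, h₁⟩ := exists_lower_bound (t := t) hr (by omega)
  obtain ⟨C, hC, N₂, h₂⟩ := exists_upper_bound hr ht
  refine ⟨c, C, hc, hC, max N₁ N₂, fun n hn => ⟨fun V _ G hV hG hdeg hGt => ?_,
    h₂ n (le_of_max_le_right hn)⟩⟩
  rw [← hV]
  exact h₁ V G (by rw [hV]; exact le_of_max_le_left hn) hG hdeg hGt
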